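/- (Hol–Scherer) Suppose G ∪ {f} ⊆ Sym ℝ[X₁,…,Xₙ]^{t×t} and the quadratic module M_G is archimedean. If f(x) is positive definite for all x ∈ S_G, then f ∈ M_G. -/

import Mathlib

open Matrix

variable (n t : ℕ)

/-- Membership in the quadratic module `M_G` generated by `G` in `ℝ[X̄]^{t×t}`. -/
def InQM (G : Set (Matrix (Fin t) (Fin t) (MvPolynomial (Fin n) ℝ)))
    (f : Matrix (Fin t) (Fin t) (MvPolynomial (Fin n) ℝ)) : Prop :=
  ∃ (N : ℕ) (g p : Fin N → Matrix (Fin t) (Fin t) (MvPolynomial (Fin n) ℝ)),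
    (∀ i, g i = 1 ∨ g i ∈ G) ∧ f = ∑ i, (p i)ᵀ * g i * p i

/-- The positivity set `S_G ⊆ ℝⁿ`. -/
def SG (G : Set (Matrix (Fin t) (Fin t) (MvPolynomial (Fin n) ℝ))) :
    Set (Fin n → ℝ) :=
  {x | ∀ g ∈ G, (g.map (MvPolynomial.eval x)).PosSemidef}

/-- `M_G` is archimedean. -/
def IsArch (G : Set (Matrix (Fin t) (Fin t) (MvPolynomial (Fin n) ℝ))) : Prop :=
  ∀ a : Matrix (Fin t) (Fin t) (MvPolynomial (Fin n) ℝ),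
    ∃ N : ℕ, InQM n t G ((N : Matrix (Fin t) (Fin t) (MvPolynomial (Fin n) ℝ)) - aᵀ * a)


/-- An element outside a pointed cone with order unit `e` is nonpositive under some pure state. -/
theorem exists_pure_state {E : Type*} [AddCommGroup E] [Module ℝ E] (C : PointedCone ℝ E) (e f : E)
    (he : e ∈ C) (hunit : ∀ a, ∃ r : ℝ, r • e + a ∈ C) (hf : f ∉ C) :
    ∃ L : E →ₗ[ℝ] ℝ, L e = 1 ∧ (∀ c ∈ C, 0 ≤ L c) ∧ L f ≤ 0 ∧
      ∀ g : E →ₗ[ℝ] ℝ, (∀ c ∈ C, 0 ≤ g c) → (∀ c ∈ C, g c ≤ L c) → ∀ a, g a = g e * L a := by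
  have vanish : ∀ g : E →ₗ[ℝ] ℝ, (∀ c ∈ C, 0 ≤ g c) → g e = 0 → ∀ a, g a = 0 := by
    intro g hg hge a
    obtain ⟨r, hr⟩ := hunit a
    obtain ⟨r', hr'⟩ := hunit (-a)
    have h1 := hg _ hr
    have h2 := hg _ hr'
    simp only [map_add, map_smul, map_neg, hge, smul_zero] at h1 h2
    linarith
  let K : Set (E → ℝ) := Set.range ((↑) : (E →ₗ[ℝ] ℝ) → E → ℝ) ∩
    {φ | φ e = 1 ∧ ∀ c ∈ C, 0 ≤ φ c}
  have hKclosed : IsClosed K := by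
    refine (LinearMap.isClosed_range_coe E ℝ (RingHom.id ℝ)).inter ?_
    refine (isClosed_eq (continuous_apply e) continuous_const).inter ?_
    have : {φ : E → ℝ | ∀ c ∈ C, 0 ≤ φ c} = ⋂ c ∈ C, {φ | 0 ≤ φ c} := by ext; simp
    change IsClosed {φ : E → ℝ | ∀ c ∈ C, 0 ≤ φ c}
    rw [this]
    exact isClosed_biInter fun c _ => isClosed_le continuous_const (continuous_apply c)
  have hKcompact : IsCompact K := by
    choose r hr using hunit
    refine (isCompact_univ_pi fun a => isCompact_Icc (a := -(r a)) (b := r (-a))).of_isClosed_subset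
      hKclosed ?_
    rintro _ ⟨⟨L, rfl⟩, h1, hL⟩ a -
    have h1' : L e = 1 := h1
    have h2 := hL _ (hr a)
    have h3 := hL _ (hr (-a))
    simp only [map_add, map_smul, map_neg, h1', smul_eq_mul, mul_one] at h2 h3
    exact ⟨by linarith, by linarith⟩
  have hKne : ∃ L : E →ₗ[ℝ] ℝ, L e = 1 ∧ (∀ c ∈ C, 0 ≤ L c) ∧ L f ≤ 0 := by
    have he0 : e ≠ 0 := by
      rintro rfl
      obtain ⟨r, hr⟩ := hunit f
      exact hf (by simpa using hr)
    let D : PointedCone ℝ E :=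
      { carrier := {x | ∃ c ∈ C, ∃ s : ℝ, 0 ≤ s ∧ x = c - s • f}
        smul_mem' := by
          rintro k _ ⟨c, hc, s, hs, rfl⟩
          exact ⟨k • c, C.smul_mem k.2 hc, k * s, mul_nonneg k.2 hs, by
            rw [smul_sub, mul_smul]; rfl⟩
        zero_mem' := ⟨0, C.zero_mem, 0, le_rfl, by simp⟩
        add_mem' := by
          rintro _ _ ⟨c, hc, s, hs, rfl⟩ ⟨c', hc', s', hs', rfl⟩
          exact ⟨c + c', C.add_mem hc hc', s + s', by positivity, by rw [add_smul]; abel⟩ }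
    have hCD : ∀ c ∈ C, c ∈ D := fun c hc => ⟨c, hc, 0, le_rfl, by simp⟩
    obtain ⟨g, hg1, hg2⟩ := riesz_extension D (LinearPMap.mkSpanSingleton (K := ℝ) e (1 : ℝ) he0)
      (by
        rintro ⟨x, hx⟩ hxD
        obtain ⟨r, rfl⟩ := Submodule.mem_span_singleton.1 hx
        rw [LinearPMap.mkSpanSingleton'_apply]
        obtain ⟨c, hc, s, hs, hcs⟩ := hxD
        simp only [smul_eq_mul, mul_one, RingHom.id_apply]
        by_contra! hr
        replace hcs : r • e = c - s • f := hcs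
        have hsf : s • f = c + (-r) • e := by
          rw [neg_smul, hcs]; abel
        have hmem : s • f ∈ C := hsf ▸ C.add_mem hc (C.smul_mem (by linarith) he)
        rcases hs.eq_or_lt with rfl | hs
        · rw [zero_smul, sub_zero] at hcs
          obtain ⟨r', hr'⟩ := hunit f
          have hre : r • e ∈ C := hcs ▸ hc
          rcases le_or_gt r' 0 with h | h
          · apply hf
            have := C.add_mem hr' (C.smul_mem (r := -r') (by linarith) he)
            convert this using 1
            module
          · apply hf
            have := C.add_mem hr' (C.smul_mem (r := r' / (-r)) (div_nonneg h.le (by linarith)) hre)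
            convert this using 1
            rw [smul_smul]
            have : r' / (-r) * r = -r' := by rw [div_neg, neg_mul, div_mul_cancel₀ _ hr.ne]
            rw [this]; module
        · apply hf
          have := C.smul_mem (inv_nonneg.2 hs.le) hmem
          rwa [smul_smul, inv_mul_cancel₀ hs.ne', one_smul] at this)
      (by
        intro y
        obtain ⟨r, hr⟩ := hunit y
        exact ⟨⟨r • e, Submodule.mem_span_singleton.2 ⟨r, rfl⟩⟩, hCD _ hr⟩)
    have hge : g e = 1 := (hg1 ⟨e, Submodule.mem_span_singleton_self e⟩).trans
      (LinearPMap.mkSpanSingleton_apply ℝ ℝ he0 1)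
    refine ⟨g, hge, fun c hc => hg2 c (hCD c hc), ?_⟩
    by_contra! hpos
    have := hg2 (e - (2 / g f) • f) ⟨e, he, _, by positivity, rfl⟩
    rw [map_sub, map_smul, hge, smul_eq_mul, div_mul_cancel₀ _ hpos.ne'] at this
    linarith
  obtain ⟨L₀, hL₀e, hL₀, hL₀f⟩ := hKne
  obtain ⟨φ, hφK, hφmin⟩ := hKcompact.exists_isMinOn ⟨_, ⟨L₀, rfl⟩, hL₀e, hL₀⟩
    (continuous_apply f).continuousOn
  have hFcompact : IsCompact (K ∩ {ψ | ψ f = φ f}) :=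
    hKcompact.inter_right (isClosed_eq (continuous_apply f) continuous_const)
  obtain ⟨ψ, hψ⟩ := hFcompact.extremePoints_nonempty ⟨φ, hφK, rfl⟩
  obtain ⟨⟨⟨⟨L, rfl⟩, hLe, hLC⟩, hLf⟩, hext⟩ := mem_extremePoints_iff_left.1 hψ
  replace hLe : L e = 1 := hLe
  replace hLf : L f = φ f := hLf
  refine ⟨L, hLe, hLC, hLf.trans_le ((hφmin (a := ⇑L₀) ⟨⟨L₀, rfl⟩, hL₀e, hL₀⟩).trans hL₀f), ?_⟩
  intro g hg hgL a
  have hle : ∀ c ∈ C, 0 ≤ (L - g) c := fun c hc => by simpa using hgL c hc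
  have hg0 := hg e he
  have hg1 := hgL e he
  rw [hLe] at hg1
  rcases hg0.eq_or_lt with h0 | h0
  · rw [← h0, zero_mul, vanish g hg h0.symm]
  rcases hg1.eq_or_lt with h1 | h1
  · have := vanish (L - g) hle (by simp [hLe, h1]) a
    rw [LinearMap.sub_apply] at this
    rw [h1]; linarith
  have h1' : 0 < 1 - g e := by linarith
  have hA : ⇑((g e)⁻¹ • g) ∈ K := ⟨⟨_, rfl⟩, by simp [h0.ne'], fun c hc =>
    mul_nonneg (inv_nonneg.2 h0.le) (hg c hc)⟩
  have hB : ⇑((1 - g e)⁻¹ • (L - g)) ∈ K := ⟨⟨_, rfl⟩, by simp [hLe, h1'.ne'], fun c hc =>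
    mul_nonneg (inv_nonneg.2 h1'.le) (hle c hc)⟩
  have hAf : L f ≤ (g e)⁻¹ * g f := hLf.trans_le (hφmin hA)
  have hBf : L f ≤ (1 - g e)⁻¹ * (L f - g f) := hLf.trans_le (hφmin hB)
  rw [← div_eq_inv_mul, le_div_iff₀ (by assumption)] at hAf hBf
  have hgf : g f = L f * g e := by linarith
  have key := hext (⇑((g e)⁻¹ • g)) ⟨hA, by
      change (g e)⁻¹ * g f = φ f
      rw [hgf, ← hLf]; field_simp⟩ (⇑((1 - g e)⁻¹ • (L - g))) ⟨hB, by
      change (1 - g e)⁻¹ * (L f - g f) = φ f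
      rw [hgf, ← hLf]; field_simp⟩
    ⟨g e, 1 - g e, h0, h1', by ring, by
      ext a
      simp only [Pi.add_apply, Pi.smul_apply, LinearMap.smul_apply, LinearMap.sub_apply,
        smul_eq_mul]
      field_simp
      ring⟩
  have := congrFun key a
  simp only [LinearMap.smul_apply, smul_eq_mul] at this
  rw [← this]; field_simp

/-- A log-convex nonnegative sequence of growth at most `c ^ k` has initial ratio at most `c`. -/
theorem le_mul_of_logConvex_of_growth (s : ℕ → ℝ) (c B : ℝ) (hc : 0 < c) (hs : ∀ k, 0 ≤ s k)
    (hconv : ∀ k, s (k + 1) ^ 2 ≤ s k * s (k + 2)) (hB : ∀ k, s k ≤ B * c ^ k) :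
    s 1 ≤ c * s 0 := by
  by_contra! h
  have h0 : 0 < s 0 := by
    refine (hs 0).lt_of_ne fun h0 => ?_
    have := hconv 0
    simp only [← h0, zero_mul, mul_zero, zero_add] at this h
    nlinarith
  set r := s 1 / s 0 with hr
  have hcr : c < r := by rwa [hr, lt_div_iff₀ h0]
  have hr0 : 0 < r := hc.trans hcr
  have step : ∀ k, 0 < s k ∧ r * s k ≤ s (k + 1) := by
    intro k
    induction k with
    | zero => exact ⟨h0, by rw [hr, div_mul_cancel₀ _ h0.ne']⟩
    | succ k ih =>
      obtain ⟨ih1, ih2⟩ := ih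
      have hpos : 0 < s (k + 1) := (mul_pos hr0 ih1).trans_le ih2
      refine ⟨hpos, ?_⟩
      have := hconv k
      have h2 : r * s (k + 1) * s k ≤ s (k + 2) * s k := by nlinarith
      exact le_of_mul_le_mul_right h2 ih1
  have hgeom : ∀ k, s 0 * r ^ k ≤ s k := by
    intro k
    induction k with
    | zero => simp
    | succ k ih =>
      calc s 0 * r ^ (k + 1) = r * (s 0 * r ^ k) := by ring
        _ ≤ r * s k := by gcongr
        _ ≤ _ := (step k).2
  obtain ⟨k, hk⟩ := pow_unbounded_of_one_lt (B / s 0) ((one_lt_div hc).2 hcr)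
  rw [div_pow, div_lt_div_iff₀ h0 (by positivity)] at hk
  linarith [hgeom k, hB k]

section QuadraticModule

variable {n t : ℕ} {G : Set (Matrix (Fin t) (Fin t) (MvPolynomial (Fin n) ℝ))}

theorem InQM.zero : InQM n t G 0 :=
  ⟨0, Fin.elim0, Fin.elim0, fun i => i.elim0, by simp⟩

theorem InQM.add {a b : Matrix (Fin t) (Fin t) (MvPolynomial (Fin n) ℝ)}
    (ha : InQM n t G a) (hb : InQM n t G b) : InQM n t G (a + b) := by
  obtain ⟨N, g, p, hg, rfl⟩ := ha
  obtain ⟨N', g', p', hg', rfl⟩ := hb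
  refine ⟨N + N', Fin.append g g', Fin.append p p', fun i => ?_, by simp [Fin.sum_univ_add]⟩
  induction i using Fin.addCases <;> simp [hg, hg']

theorem InQM.conj {a : Matrix (Fin t) (Fin t) (MvPolynomial (Fin n) ℝ)} (ha : InQM n t G a)
    (q : Matrix (Fin t) (Fin t) (MvPolynomial (Fin n) ℝ)) : InQM n t G (qᵀ * a * q) := by
  obtain ⟨N, g, p, hg, rfl⟩ := ha
  exact ⟨N, g, fun i => p i * q, hg, by
    simp [Finset.mul_sum, Finset.sum_mul, Matrix.mul_assoc, Matrix.transpose_mul]⟩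

theorem InQM.of_mem {g : Matrix (Fin t) (Fin t) (MvPolynomial (Fin n) ℝ)} (hg : g = 1 ∨ g ∈ G) :
    InQM n t G g :=
  ⟨1, fun _ => g, fun _ => 1, fun _ => hg, by simp⟩

theorem InQM.transpose_mul_self (q : Matrix (Fin t) (Fin t) (MvPolynomial (Fin n) ℝ)) :
    InQM n t G (qᵀ * q) := by
  simpa using (InQM.of_mem (G := G) (Or.inl rfl)).conj q

theorem InQM.sq_smul {a : Matrix (Fin t) (Fin t) (MvPolynomial (Fin n) ℝ)} (ha : InQM n t G a)
    (b : MvPolynomial (Fin n) ℝ) : InQM n t G (b ^ 2 • a) := by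
  simpa [smul_smul, sq] using ha.conj (b • 1)

theorem InQM.smul {a : Matrix (Fin t) (Fin t) (MvPolynomial (Fin n) ℝ)} (ha : InQM n t G a)
    {r : ℝ} (hr : 0 ≤ r) : InQM n t G (r • a) := by
  convert ha.sq_smul (MvPolynomial.C √r) using 1
  rw [← map_pow, Real.sq_sqrt hr, ← MvPolynomial.algebraMap_eq, algebraMap_smul]

theorem InQM.transpose_eq (hG : ∀ g ∈ G, gᵀ = g)
    {a : Matrix (Fin t) (Fin t) (MvPolynomial (Fin n) ℝ)} (ha : InQM n t G a) : aᵀ = a := by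
  obtain ⟨N, g, p, hg, rfl⟩ := ha
  have hgt : ∀ i, (g i)ᵀ = g i := fun i =>
    (hg i).elim (fun h => by rw [h, Matrix.transpose_one]) (hG _)
  simp [Matrix.transpose_sum, Matrix.transpose_mul, Matrix.mul_assoc, hgt]

variable (G) in
/-- The cone of matrices whose symmetrization lies in the quadratic module of `G`. -/
def symmetrizedCone : PointedCone ℝ (Matrix (Fin t) (Fin t) (MvPolynomial (Fin n) ℝ)) where
  carrier := {a | InQM n t G (a + aᵀ)}
  add_mem' := by
    intro a b ha hb
    have := InQM.add ha hb
    rwa [add_add_add_comm, ← Matrix.transpose_add] at this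
  zero_mem' := by simpa using InQM.zero (G := G)
  smul_mem' := by
    intro r a ha
    have := InQM.smul ha r.2
    rwa [smul_add, ← Matrix.transpose_smul] at this

theorem mem_symmetrizedCone {a : Matrix (Fin t) (Fin t) (MvPolynomial (Fin n) ℝ)} :
    a ∈ symmetrizedCone G ↔ InQM n t G (a + aᵀ) := Iff.rfl

theorem InQM.mem_symmetrizedCone (hG : ∀ g ∈ G, gᵀ = g)
    {a : Matrix (Fin t) (Fin t) (MvPolynomial (Fin n) ℝ)} (ha : InQM n t G a) :
    a ∈ symmetrizedCone G := by
  rw [_root_.mem_symmetrizedCone, ha.transpose_eq hG]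
  exact ha.add ha

theorem inQM_of_mem_symmetrizedCone {a : Matrix (Fin t) (Fin t) (MvPolynomial (Fin n) ℝ)}
    (ha : a ∈ symmetrizedCone G) (hsymm : aᵀ = a) : InQM n t G a := by
  rw [mem_symmetrizedCone, hsymm] at ha
  convert ha.smul (r := 1 / 2) (by norm_num) using 1
  module

theorem sq_smul_mem_symmetrizedCone {a : Matrix (Fin t) (Fin t) (MvPolynomial (Fin n) ℝ)}
    (ha : a ∈ symmetrizedCone G) (b : MvPolynomial (Fin n) ℝ) :
    b ^ 2 • a ∈ symmetrizedCone G := by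
  rw [mem_symmetrizedCone] at ha ⊢
  rw [Matrix.transpose_smul, ← smul_add]
  exact ha.sq_smul b

theorem natCast_eq_smul_one (N : ℕ) :
    (N : Matrix (Fin t) (Fin t) (MvPolynomial (Fin n) ℝ)) = (N : ℝ) • 1 := by
  rw [Nat.cast_smul_eq_nsmul, nsmul_one]

theorem IsArch.exists_smul_one_add_mem (harch : IsArch n t G)
    (a : Matrix (Fin t) (Fin t) (MvPolynomial (Fin n) ℝ)) :
    ∃ r : ℝ, r • 1 + a ∈ symmetrizedCone G := by
  obtain ⟨N, hN⟩ := harch (a + aᵀ)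
  have h := (hN.add (InQM.transpose_mul_self (a + aᵀ + 1))).smul (r := 1 / 2) (by norm_num)
  refine ⟨(N + 1) / 4, ?_⟩
  rw [mem_symmetrizedCone]
  convert h using 1
  simp only [Matrix.transpose_add, Matrix.transpose_transpose, Matrix.transpose_smul,
    Matrix.transpose_one, natCast_eq_smul_one, add_comm aᵀ a]
  simp only [mul_add, add_mul, mul_one, one_mul]
  module

/-- A state on the archimedean quadratic module is dominated when multiplied by a bounded square. -/
theorem IsArch.exists_sq_smul_le (hG : ∀ g ∈ G, gᵀ = g) (harch : IsArch n t G)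
    {L : Matrix (Fin t) (Fin t) (MvPolynomial (Fin n) ℝ) →ₗ[ℝ] ℝ}
    (hL : ∀ a ∈ symmetrizedCone G, 0 ≤ L a) (hL1 : L 1 = 1) (b : MvPolynomial (Fin n) ℝ) :
    ∃ c : ℝ, 0 < c ∧ ∀ h ∈ symmetrizedCone G, L (b ^ 2 • h) ≤ c * L h := by
  obtain ⟨N, hN⟩ := harch (b • 1)
  have hc : (0 : ℝ) < N + 1 := by positivity
  have hbound : ∀ k, L (b ^ (2 * k) • 1) ≤ (N + 1 : ℝ) ^ k := by
    intro k
    induction k with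
    | zero => simp [hL1]
    | succ k ih =>
      have hmem := hL _ (sq_smul_mem_symmetrizedCone (hN.mem_symmetrizedCone hG) (b ^ k))
      have hone := hL _ (sq_smul_mem_symmetrizedCone
        ((InQM.of_mem (G := G) (Or.inl rfl)).mem_symmetrizedCone hG) (b ^ k))
      have heq : (b ^ k) ^ 2 • ((N : Matrix (Fin t) (Fin t) (MvPolynomial (Fin n) ℝ)) -
          (b • 1)ᵀ * (b • 1)) = (N : ℝ) • (b ^ (2 * k) • 1) - b ^ (2 * (k + 1)) • 1 := by
        rw [natCast_eq_smul_one, smul_sub, smul_comm ((b ^ k) ^ 2) (N : ℝ)]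
        simp only [Matrix.transpose_smul, Matrix.transpose_one, Matrix.mul_smul, mul_one,
          smul_smul]
        ring_nf
      rw [heq, map_sub, map_smul, smul_eq_mul] at hmem
      rw [← pow_mul, mul_comm k 2] at hone
      rw [pow_succ]
      nlinarith
  refine ⟨N + 1, hc, fun h hh => ?_⟩
  obtain ⟨r, hr⟩ := harch.exists_smul_one_add_mem (-h)
  have hr0 : 0 ≤ r := by
    have h1 := hL _ hr
    have h2 := hL _ hh
    simp only [map_add, map_smul, map_neg, hL1, smul_eq_mul, mul_one] at h1
    linarith
  have key := le_mul_of_logConvex_of_growth (fun k => L (b ^ (2 * k) • h)) (N + 1) r hc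
    (fun k => by
      rw [mul_comm, pow_mul]
      exact hL _ (sq_smul_mem_symmetrizedCone hh _))
    (fun k => by
      have hd := discrim_le_zero (a := L (b ^ (2 * (k + 2)) • h))
        (b := 2 * L (b ^ (2 * (k + 1)) • h)) (c := L (b ^ (2 * k) • h)) (fun x => by
          have := hL _ (sq_smul_mem_symmetrizedCone hh
            (b ^ k * (1 + MvPolynomial.C x * b ^ 2)))
          have heq : (b ^ k * (1 + MvPolynomial.C x * b ^ 2)) ^ 2 • h =
              (x * x) • (b ^ (2 * (k + 2)) • h) + (2 * x) • (b ^ (2 * (k + 1)) • h) +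
                b ^ (2 * k) • h := by
            simp only [← algebraMap_smul (MvPolynomial (Fin n) ℝ) (_ : ℝ) (_ : Matrix _ _ _),
              MvPolynomial.algebraMap_eq, smul_smul, ← add_smul, map_mul, map_ofNat]
            congr 1
            ring
          rw [heq] at this
          simp only [map_add, map_smul, smul_eq_mul] at this
          linarith)
      rw [discrim] at hd
      nlinarith)
    (fun k => by
      have h1 := hL _ (sq_smul_mem_symmetrizedCone hr (b ^ k))
      rw [smul_add, smul_comm, smul_neg, map_add, map_neg, map_smul, ← pow_mul, mul_comm k,
        smul_eq_mul] at h1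
      have := mul_le_mul_of_nonneg_left (hbound k) hr0
      linarith)
  simpa using key

/-- A pure state of an archimedean quadratic module factors through evaluation at a point. -/
theorem IsArch.exists_eval_of_pure (hG : ∀ g ∈ G, gᵀ = g) (harch : IsArch n t G)
    {L : Matrix (Fin t) (Fin t) (MvPolynomial (Fin n) ℝ) →ₗ[ℝ] ℝ}
    (hL : ∀ a ∈ symmetrizedCone G, 0 ≤ L a) (hL1 : L 1 = 1)
    (hpure : ∀ g : Matrix (Fin t) (Fin t) (MvPolynomial (Fin n) ℝ) →ₗ[ℝ] ℝ,
      (∀ a ∈ symmetrizedCone G, 0 ≤ g a) → (∀ a ∈ symmetrizedCone G, g a ≤ L a) →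
        ∀ a, g a = g 1 * L a) :
    ∃ x : Fin n → ℝ, ∀ p h, L (p • h) = MvPolynomial.eval x p * L h := by
  have hsq : ∀ (b : MvPolynomial (Fin n) ℝ) h, L (b ^ 2 • h) = L (b ^ 2 • 1) * L h := by
    intro b h
    obtain ⟨c, hc, hcL⟩ := harch.exists_sq_smul_le hG hL hL1 b
    have := hpure (c⁻¹ • L ∘ₗ Algebra.lsmul ℝ ℝ _ (b ^ 2))
      (fun a ha => mul_nonneg (inv_nonneg.2 hc.le) (hL _ (sq_smul_mem_symmetrizedCone ha b)))
      (fun a ha => (inv_mul_le_iff₀ hc).2 (hcL a ha)) h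
    simp only [LinearMap.smul_apply, LinearMap.comp_apply, Algebra.lsmul_coe, smul_eq_mul,
      mul_assoc] at this
    exact mul_left_cancel₀ (inv_ne_zero hc.ne') this
  have hmul : ∀ (b : MvPolynomial (Fin n) ℝ) h, L (b • h) = L (b • 1) * L h := by
    intro b h
    have heq : ∀ h : Matrix (Fin t) (Fin t) (MvPolynomial (Fin n) ℝ),
        L ((b + 1) ^ 2 • h) = L (b ^ 2 • h) + 2 * L (b • h) + L h := by
      intro h
      rw [add_sq, add_smul, add_smul, map_add, map_add, mul_one, one_pow, one_smul, mul_smul,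
        ofNat_smul_eq_nsmul, map_nsmul, nsmul_eq_mul, Nat.cast_ofNat]
    have h1 := hsq (b + 1) h
    rw [heq, heq, hsq b h, hL1] at h1
    linarith
  refine ⟨fun i => L ((MvPolynomial.X i : MvPolynomial (Fin n) ℝ) • 1), fun p => ?_⟩
  induction p using MvPolynomial.induction_on with
  | C a => intro h; rw [← MvPolynomial.algebraMap_eq, algebraMap_smul]; simp
  | add p q hp hq => intro h; rw [add_smul, map_add, hp, hq, map_add, add_mul]
  | mul_X p i hp => intro h; rw [mul_smul, hp, hmul, map_mul, MvPolynomial.eval_X, mul_assoc]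

end QuadraticModule

/-- **Hol–Scherer.** If `M_G` is archimedean and `f` is symmetric with `f(x) ≻ 0` for all
`x ∈ S_G`, then `f ∈ M_G`. -/
theorem stmt13 (G : Set (Matrix (Fin t) (Fin t) (MvPolynomial (Fin n) ℝ)))
    (hG : ∀ g ∈ G, gᵀ = g) (harch : IsArch n t G)
    (f : Matrix (Fin t) (Fin t) (MvPolynomial (Fin n) ℝ)) (hf : fᵀ = f)
    (hpos : ∀ x ∈ SG n t G, (f.map (MvPolynomial.eval x)).PosDef) :
    InQM n t G f := by
  refine inQM_of_mem_symmetrizedCone ?_ hf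
  by_contra hfC
  obtain ⟨L, hL1, hL, hLf, hpure⟩ := exists_pure_state (symmetrizedCone G) 1 f
    ((InQM.of_mem (Or.inl rfl)).mem_symmetrizedCone hG) harch.exists_smul_one_add_mem hfC
  obtain ⟨x, hx⟩ := harch.exists_eval_of_pure hG hL hL1 hpure
  have hLM : ∀ a, InQM n t G a → 0 ≤ L a := fun a ha => hL a (ha.mem_symmetrizedCone hG)
  have hLeval : ∀ h, L h = L ((h.map (MvPolynomial.eval x)).map MvPolynomial.C) := by
    intro h
    have hsum : ∀ h : Matrix (Fin t) (Fin t) (MvPolynomial (Fin n) ℝ),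
        L h = ∑ i, ∑ j, MvPolynomial.eval x (h i j) * L (single i j 1) := by
      intro h
      conv_lhs => rw [matrix_eq_sum_single h]
      simp only [map_sum]
      refine Finset.sum_congr rfl fun i _ => Finset.sum_congr rfl fun j _ => ?_
      rw [← hx, smul_single, smul_eq_mul, mul_one]
    rw [hsum h, hsum (Matrix.map _ _)]
    simp
  have hpsd : ∀ H : Matrix (Fin t) (Fin t) ℝ, H.PosSemidef → 0 ≤ L (H.map MvPolynomial.C) := by
    intro H hH
    open scoped MatrixOrder Matrix.Norms.L2Operator in
    obtain ⟨B, rfl⟩ := CStarAlgebra.nonneg_iff_eq_star_mul_self.mp hH.nonneg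
    rw [star_eq_conjTranspose, conjTranspose_eq_transpose_of_trivial, Matrix.map_mul,
      transpose_map]
    exact hLM _ (InQM.transpose_mul_self _)
  have hxS : x ∈ SG n t G := by
    intro g hg
    obtain ⟨i, hi⟩ : ∃ i, 0 < L (single i i 1) := by
      by_contra! hle
      have : (1 : Matrix (Fin t) (Fin t) (MvPolynomial (Fin n) ℝ)) = ∑ i, single i i 1 := by
        ext i j
        simp [Matrix.sum_apply, Matrix.one_apply, single_apply, ite_and]
      have h1 := hL1
      rw [this, map_sum] at h1
      linarith [Finset.sum_nonpos fun i (_ : i ∈ Finset.univ) => hle i]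
    refine .of_dotProduct_mulVec_nonneg ?_ fun v => ?_
    · rw [IsHermitian, conjTranspose_eq_transpose_of_trivial, ← transpose_map, hG g hg]
    · let w : Fin t → MvPolynomial (Fin n) ℝ := fun k => MvPolynomial.C (v k)
      have hq := hLM _ ((InQM.of_mem (Or.inr hg)).conj (vecMulVec w (Pi.single i 1)))
      have heq : (vecMulVec w (Pi.single i 1))ᵀ * g * vecMulVec w (Pi.single i 1) =
          (w ⬝ᵥ g *ᵥ w) • single i i 1 := by
        rw [transpose_vecMulVec, Matrix.mul_assoc, mul_vecMulVec, vecMulVec_mul_vecMulVec]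
        ext1 k l
        by_cases hk : k = i <;> by_cases hl : l = i <;>
          simp [vecMulVec_apply, hk, hl, eq_comm (a := i)]
      rw [heq, hx] at hq
      have hev : MvPolynomial.eval x (w ⬝ᵥ g *ᵥ w) =
          star v ⬝ᵥ g.map (MvPolynomial.eval x) *ᵥ v := by
        simp [dotProduct, mulVec, w]
      rw [← hev]
      exact nonneg_of_mul_nonneg_left hq hi
  set F := f.map (MvPolynomial.eval x) with hF
  have hFpos : F.PosDef := hpos x hxS
  have hquad : ∀ s : ℝ, 0 ≤ s * s * L (F⁻¹.map MvPolynomial.C) + 2 * s + L f := by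
    intro s
    have hsymm : Fᴴ = F := hFpos.isHermitian
    have h1 := hpsd _ (hFpos.inv.posSemidef.conjTranspose_mul_mul_same (s • 1 + F))
    have hdet : IsUnit F.det := (Matrix.isUnit_iff_isUnit_det _).1 hFpos.isUnit
    have h2 : (s • 1 + F)ᴴ * F⁻¹ * (s • 1 + F) = (s * s) • F⁻¹ + (2 * s) • 1 + F := by
      rw [conjTranspose_add, hsymm, conjTranspose_smul, conjTranspose_one, star_trivial, add_mul,
        add_mul, mul_add, mul_add, mul_nonsing_inv _ hdet]
      simp only [Matrix.smul_mul, Matrix.mul_smul, mul_one, one_mul, smul_smul,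
        nonsing_inv_mul _ hdet]
      module
    have h3 : ∀ (r : ℝ) (H : Matrix (Fin t) (Fin t) ℝ),
        (r • H).map (MvPolynomial.C (σ := Fin n)) = r • H.map MvPolynomial.C := by
      intro r H
      ext1 i j
      simp [MvPolynomial.smul_eq_C_mul]
    rw [h2, Matrix.map_add _ (map_add _), Matrix.map_add _ (map_add _), h3, h3,
      Matrix.map_one _ (map_zero _) (map_one _), map_add, map_add, map_smul, map_smul, hL1,
      ← hLeval] at h1
    simpa using h1
  have := discrim_le_zero (a := L (F⁻¹.map MvPolynomial.C)) (b := 2) (c := L f)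
    fun s => by linarith [hquad s]
  have hLinv := hpsd _ hFpos.inv.posSemidef
  rw [discrim] at this
  nlinarith
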